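/- Let M be a nonempty closed subset of ℝ having no large holes at infinity. Then any two self-adjoint operators A, B on H with σ_ess(A) = σ_ess(B) = M are Weyl–von Neumann equivalent: there exist a unitary u on H and a compact self-adjoint operator K with uAu* + K = B. -/

import Mathlib

open Filter Metric Topology LinearPMap

noncomputable section

variable {H : Type*} [NormedAddCommGroup H] [InnerProductSpace ℂ H] [CompleteSpace H]

/-- A (possibly unbounded) self-adjoint operator: densely defined and equal to its adjoint. -/
def IsSelfAdjointOp (A : H →ₗ.[ℂ] H) : Prop :=
  Dense (A.domain : Set H) ∧ A.adjoint = A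

/-- The essential spectrum of a (partially defined) operator: the set of real `t` admitting an
orthonormal sequence in the domain along which `‖A xₙ - t • xₙ‖ → 0`. -/
def essSpec (A : H →ₗ.[ℂ] H) : Set ℝ :=
  {t | ∃ x : ℕ → A.domain, Orthonormal ℂ (fun n => (x n : H)) ∧
    Tendsto (fun n => ‖A (x n) - (t : ℂ) • (x n : H)‖) atTop (𝓝 0)}

/-- Weyl–von Neumann equivalence: `u A u* + K = B` for some unitary `u` and
compact self-adjoint `K`. -/
def WvNEquiv (A B : H →ₗ.[ℂ] H) : Prop :=
  ∃ (u : H ≃ₗᵢ[ℂ] H) (K : H →L[ℂ] H), IsCompactOperator K ∧ IsSelfAdjoint K ∧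
    B.domain = A.domain.map (u.toLinearEquiv : H →ₗ[ℂ] H) ∧
    ∀ (x : A.domain) (hx : u (x : H) ∈ B.domain), B ⟨u (x : H), hx⟩ = u (A x) + K (u (x : H))

/-- `M` has no large holes at infinity. -/
def NoLargeHoles (M : Set ℝ) : Prop :=
  M.Nonempty ∧ ∀ ε > 0, ∃ N > 0, ∀ l : ℝ, l ∉ M → |l| > N → infDist l M < ε

end

section Resolvent

variable {H : Type*} [NormedAddCommGroup H] [InnerProductSpace ℂ H] [CompleteSpace H]
  {A : H →ₗ.[ℂ] H}

theorem IsSelfAdjointOp.inner_left (hA : IsSelfAdjointOp A) (x y : A.domain) :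
    inner ℂ (A x) (y : H) = inner ℂ (x : H) (A y) := by
  have h := adjoint_isFormalAdjoint hA.1
  rw [hA.2] at h
  exact h x y

theorem IsSelfAdjointOp.mem_domain_of_inner (hA : IsSelfAdjointOp A) {y w : H}
    (h : ∀ x : A.domain, inner ℂ w (x : H) = inner ℂ y (A x)) : y ∈ A.domain := by
  rw [← hA.2]
  exact mem_adjoint_domain_of_exists _ ⟨w, h⟩

theorem IsSelfAdjointOp.apply_eq_of_inner (hA : IsSelfAdjointOp A) {y : A.domain} {w : H}
    (h : ∀ x : A.domain, inner ℂ w (x : H) = inner ℂ (y : H) (A x)) : A y = w := by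
  refine hA.1.eq_of_inner_left ℂ fun x hx => ?_
  rw [hA.inner_left y ⟨x, hx⟩, h ⟨x, hx⟩]

theorem IsSelfAdjointOp.mem_domain_of_bound (hA : IsSelfAdjointOp A) {y : H} (C : ℝ)
    (h : ∀ x : A.domain, ‖inner ℂ y (A x)‖ ≤ C * ‖(x : H)‖) : y ∈ A.domain := by
  rw [← hA.2, mem_adjoint_domain_iff]
  exact AddMonoidHomClass.continuous_of_bound ((innerₛₗ ℂ y).comp A.toFun) C fun x => h x

theorem IsSelfAdjointOp.norm_sub_smul_sq (hA : IsSelfAdjointOp A) {c : ℂ} (hc : c.re = 0)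
    (x : A.domain) :
    ‖A x - c • (x : H)‖ ^ 2 = ‖A x‖ ^ 2 + (‖c‖ * ‖(x : H)‖) ^ 2 := by
  have him : (inner ℂ (A x) (x : H)).im = 0 := by
    have h := inner_conj_symm (A x) (x : H) (𝕜 := ℂ)
    rw [← hA.inner_left] at h
    exact Complex.conj_eq_iff_im.1 h
  rw [@norm_sub_sq ℂ, inner_smul_right, norm_smul]
  have : RCLike.re (c * inner ℂ (A x) (x : H)) = 0 := by
    change (c * inner ℂ (A x) (x : H)).re = 0
    rw [Complex.mul_re, hc, him]; ring
  rw [this]; ring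

/-- The operator `A - c` is bijective for imaginary `c ≠ 0`. -/
theorem IsSelfAdjointOp.exists_resolvent (hA : IsSelfAdjointOp A) {c : ℂ} (hc : c.re = 0)
    (hc1 : ‖c‖ = 1) :
    ∃ R : H →L[ℂ] H, (∀ z, ∃ h : R z ∈ A.domain, A ⟨R z, h⟩ - c • R z = z) ∧
      ∀ x : A.domain, R (A x - c • (x : H)) = x := by
  set T : A.domain →ₗ[ℂ] H := A.toFun - c • A.domain.subtype with hT
  have hTx : ∀ x, T x = A x - c • (x : H) := fun x => rfl
  have hbound : ∀ x : A.domain, ‖(x : H)‖ ≤ ‖T x‖ := by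
    intro x
    have h := hA.norm_sub_smul_sq hc x
    rw [hc1, one_mul] at h
    rw [hTx]
    nlinarith [norm_nonneg (x : H), norm_nonneg (A x - c • (x : H)), sq_nonneg ‖A x‖]
  have hinj : Function.Injective T := by
    rw [← LinearMap.ker_eq_bot, LinearMap.ker_eq_bot']
    intro x hx
    have := hbound x
    rw [hx, norm_zero] at this
    exact Subtype.ext (norm_le_zero_iff.1 this)
  have hclosed : IsClosed (T.range : Set H) := by
    refine isClosed_of_closure_subset fun z hz => ?_
    obtain ⟨w, hw, hwz⟩ := mem_closure_iff_seq_limit.1 hz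
    choose x hx using hw
    have hcx : CauchySeq fun n => (x n : H) := by
      rw [Metric.cauchySeq_iff']
      intro ε hε
      obtain ⟨N, hN⟩ := Metric.cauchySeq_iff'.1 hwz.cauchySeq ε hε
      refine ⟨N, fun n hn => lt_of_le_of_lt ?_ (hN n hn)⟩
      have := hbound (x n - x N)
      rw [_root_.map_sub, hx, hx] at this
      rwa [dist_eq_norm, dist_eq_norm]
    obtain ⟨y, hy⟩ := cauchySeq_tendsto_of_complete hcx
    have hin : ∀ v : A.domain, inner ℂ (z + c • y) (v : H) = inner ℂ y (A v) := by
      intro v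
      have h1 : Tendsto (fun n => inner ℂ (w n + c • (x n : H)) (v : H)) atTop
          (𝓝 (inner ℂ (z + c • y) (v : H))) :=
        (hwz.add (hy.const_smul c)).inner tendsto_const_nhds
      have h2 : Tendsto (fun n => inner ℂ (x n : H) (A v)) atTop (𝓝 (inner ℂ y (A v))) :=
        hy.inner tendsto_const_nhds
      refine tendsto_nhds_unique h1 (h2.congr fun n => ?_)
      rw [← hA.inner_left, ← hx n, hTx]
      simp
    have hyd := hA.mem_domain_of_inner hin
    refine ⟨⟨y, hyd⟩, ?_⟩
    rw [hTx, hA.apply_eq_of_inner (y := ⟨y, hyd⟩) hin]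
    simp
  have hsurj : T.range = ⊤ := by
    have : CompleteSpace T.range := hclosed.completeSpace_coe
    rw [← Submodule.orthogonal_eq_bot_iff, Submodule.eq_bot_iff]
    intro y hy
    have hin : ∀ v : A.domain, inner ℂ ((starRingEnd ℂ c) • y) (v : H) = inner ℂ y (A v) := by
      intro v
      have h := (Submodule.mem_orthogonal' _ _).1 hy (T v) ⟨v, rfl⟩
      rw [hTx, inner_sub_right, inner_smul_right, sub_eq_zero] at h
      rw [h, inner_smul_left, Complex.conj_conj]
    have hyd := hA.mem_domain_of_inner hin
    have h1 := hA.apply_eq_of_inner (y := ⟨y, hyd⟩) hin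
    have h2 := hA.norm_sub_smul_sq (c := starRingEnd ℂ c) (by simpa using hc) ⟨y, hyd⟩
    rw [h1] at h2
    simp [hc1, norm_smul] at h2
    exact norm_eq_zero.1 (by nlinarith [norm_nonneg y])
  let e := LinearEquiv.ofBijective T ⟨hinj, LinearMap.range_eq_top.1 hsurj⟩
  have he : ∀ x, e x = T x := fun x => rfl
  refine ⟨(A.domain.subtype.comp (e.symm : H →ₗ[ℂ] A.domain)).mkContinuous 1 fun z => ?_,
    fun z => ⟨(e.symm z).2, ?_⟩, fun x => ?_⟩
  · have := hbound (e.symm z)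
    rw [← he, e.apply_symm_apply] at this
    simpa using this
  · have := e.apply_symm_apply z
    rw [he, hTx] at this
    exact this
  · change ((e.symm (T x) : A.domain) : H) = x
    rw [← he, e.symm_apply_apply]

end Resolvent

section SpectralSubspaces

variable {H : Type*} [NormedAddCommGroup H] [InnerProductSpace ℂ H] [CompleteSpace H]

/-- The spectral subspace of a bounded self-adjoint operator for the interval `(-∞, 0]`,
described as the kernel of the positive part. -/
noncomputable def nonposSpace (h : H →L[ℂ] H) : Submodule ℂ H :=
  LinearMap.ker ((h⁺ : H →L[ℂ] H) : H →ₗ[ℂ] H)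

variable {h k : H →L[ℂ] H}

theorem mem_nonposSpace {x : H} : x ∈ nonposSpace h ↔ h⁺ x = 0 := Iff.rfl

theorem isClosed_nonposSpace (h : H →L[ℂ] H) : IsClosed (nonposSpace h : Set H) :=
  ContinuousLinearMap.isClosed_ker _

instance (h : H →L[ℂ] H) : (nonposSpace h).HasOrthogonalProjection :=
  have : CompleteSpace (nonposSpace h) := (isClosed_nonposSpace h).completeSpace_coe
  inferInstance

theorem commute_posPart (hk : Commute h k) : Commute h⁺ k := by
  rw [CFC.posPart_def]
  exact hk.cfcₙ_real _

theorem nonposSpace_invariant (hk : Commute h k) {x : H} (hx : x ∈ nonposSpace h) :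
    k x ∈ nonposSpace h := by
  rw [mem_nonposSpace] at hx ⊢
  have := congrArg (fun f : H →L[ℂ] H => f x) (commute_posPart hk).eq
  simp only [mul_apply_eq_comp, hx, _root_.map_zero] at this
  exact this

theorem nonposSpace_orthogonal_invariant (hh : IsSelfAdjoint h) (hk : Commute h k) {x : H}
    (hx : x ∈ (nonposSpace h)ᗮ) : k x ∈ (nonposSpace h)ᗮ := by
  rw [Submodule.mem_orthogonal] at hx ⊢
  intro u hu
  have hk' : Commute h (ContinuousLinearMap.adjoint k) := by
    have := hk.star_star
    rw [hh.star_eq] at this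
    exact this
  rw [← ContinuousLinearMap.adjoint_inner_left]
  exact hx _ (nonposSpace_invariant hk' hu)

theorem re_inner_nonpos_of_mem_nonposSpace (hh : IsSelfAdjoint h) {x : H}
    (hx : x ∈ nonposSpace h) : (inner ℂ (h x) x).re ≤ 0 := by
  have h1 := congrArg (fun f : H →L[ℂ] H => f x) (CFC.posPart_sub_negPart h hh)
  simp only [_root_.sub_apply, mem_nonposSpace.1 hx] at h1
  have h2 : 0 ≤ (h⁻ : H →L[ℂ] H) := CFC.negPart_nonneg h
  rw [ContinuousLinearMap.nonneg_iff_isPositive] at h2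
  have h3 := h2.re_inner_nonneg_left x
  rw [← h1, zero_sub, inner_neg_left, Complex.neg_re]
  simpa using h3

theorem re_inner_nonneg_of_mem_orthogonal (hh : IsSelfAdjoint h) {x : H}
    (hx : x ∈ (nonposSpace h)ᗮ) : 0 ≤ (inner ℂ (h x) x).re := by
  have h1 := congrArg (fun f : H →L[ℂ] H => f x) (CFC.posPart_sub_negPart h hh)
  have h2 : 0 ≤ (h⁺ : H →L[ℂ] H) := CFC.posPart_nonneg h
  rw [ContinuousLinearMap.nonneg_iff_isPositive] at h2
  have h3 := h2.re_inner_nonneg_left x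
  have h4 : h⁻ x ∈ nonposSpace h := by
    have := congrArg (fun f : H →L[ℂ] H => f x) (CFC.posPart_mul_negPart h)
    exact this
  have h5 := (Submodule.mem_orthogonal _ _).1 hx _ h4
  rw [← h1, _root_.sub_apply, inner_sub_left, h5, sub_zero]
  simpa using h3

theorem starProjection_nonposSpace_mem (hk : IsSelfAdjoint k) (hhk : Commute h k) {x : H}
    (hx : x ∈ nonposSpace h) : (nonposSpace k).starProjection x ∈ nonposSpace h := by
  set p := (nonposSpace k).starProjection x with hp
  have hp1 : p ∈ nonposSpace k := Submodule.starProjection_apply_mem _ _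
  have hp2 : x - p ∈ (nonposSpace k)ᗮ := Submodule.sub_starProjection_mem_orthogonal _
  have h1 : h⁺ p ∈ nonposSpace k := nonposSpace_invariant (commute_posPart hhk).symm hp1
  have h2 : h⁺ (x - p) ∈ (nonposSpace k)ᗮ :=
    nonposSpace_orthogonal_invariant hk (commute_posPart hhk).symm hp2
  rw [_root_.map_sub, mem_nonposSpace.1 hx, zero_sub, Submodule.neg_mem_iff] at h2
  rw [mem_nonposSpace]
  exact inner_self_eq_zero.1 ((Submodule.mem_orthogonal _ _).1 h2 _ h1)

end SpectralSubspaces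

section Reducing

variable {H : Type*} [NormedAddCommGroup H] [InnerProductSpace ℂ H] [CompleteSpace H]
  {A : H →ₗ.[ℂ] H} {R : H →L[ℂ] H}

theorem mem_of_resolvent_mem {H : Type*} [NormedAddCommGroup H] [InnerProductSpace ℂ H]
    {R : H →L[ℂ] H} (hinj : Function.Injective R) {E : Submodule ℂ H}
    [E.HasOrthogonalProjection] (hE : ∀ x ∈ E, R x ∈ E) (hE' : ∀ x ∈ Eᗮ, R x ∈ Eᗮ)
    {z : H} (hz : R z ∈ E) : z ∈ E := by
  have h1 := hE _ (Submodule.starProjection_apply_mem E z)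
  have h2 := hE' _ (Submodule.sub_starProjection_mem_orthogonal (K := E) z)
  have h3 : R (z - E.starProjection z) ∈ E := by
    rw [_root_.map_sub]; exact E.sub_mem hz h1
  have h4 : R (z - E.starProjection z) = 0 :=
    inner_self_eq_zero.1 ((Submodule.mem_orthogonal _ _).1 h2 _ h3)
  rw [← R.map_zero] at h4
  rw [sub_eq_zero.1 (hinj h4)]
  exact Submodule.starProjection_apply_mem E z

/-- A reducing subspace on which `A` is bounded consists of vectors of the domain. -/
theorem IsSelfAdjointOp.bounded_on_reducing (hA : IsSelfAdjointOp A) {c : ℂ}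
    (hR : ∀ z, ∃ h : R z ∈ A.domain, A ⟨R z, h⟩ - c • R z = z)
    (hR' : ∀ x : A.domain, R (A x - c • (x : H)) = x) {E : Submodule ℂ H}
    [E.HasOrthogonalProjection] (hE : ∀ x ∈ E, R x ∈ E) (hE' : ∀ x ∈ Eᗮ, R x ∈ Eᗮ)
    {N : ℝ} (hN0 : 0 ≤ N) (hN : ∀ x ∈ E, ‖x + c • R x‖ ≤ N * ‖R x‖) {x : H} (hx : x ∈ E) :
    ∃ h : x ∈ A.domain, A ⟨x, h⟩ ∈ E ∧ ‖A ⟨x, h⟩‖ ≤ N * ‖x‖ := by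
  have hinj : Function.Injective R := by
    rw [injective_iff_map_eq_zero]
    intro z hz
    obtain ⟨h, h2⟩ := hR z
    have : (⟨R z, h⟩ : A.domain) = 0 := Subtype.ext hz
    rw [this, hz, LinearPMap.map_zero] at h2
    simpa using h2.symm
  have hAR : ∀ z, ∀ h : R z ∈ A.domain, A ⟨R z, h⟩ = z + c • R z := fun z h => by
    rw [← sub_eq_iff_eq_add]; exact (hR z).2
  have hxd : x ∈ A.domain := by
    refine hA.mem_domain_of_bound (‖x‖ * N) fun y => ?_
    obtain ⟨z, hz⟩ : ∃ z, R z = y := ⟨_, hR' y⟩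
    set z1 := E.starProjection z
    have hz1 : z1 ∈ E := Submodule.starProjection_apply_mem E z
    have hz2 : z - z1 ∈ Eᗮ := Submodule.sub_starProjection_mem_orthogonal (K := E) z
    have hsum : A y = (z1 + c • R z1) + ((z - z1) + c • R (z - z1)) := by
      have : y = ⟨R z, (hR z).1⟩ := Subtype.ext hz.symm
      rw [this, hAR, _root_.map_sub]
      module
    have horth : inner ℂ x ((z - z1) + c • R (z - z1)) = 0 :=
      (Submodule.mem_orthogonal _ _).1 (Eᗮ.add_mem hz2 (Eᗮ.smul_mem c (hE' _ hz2))) x hx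
    rw [hsum, inner_add_right, horth, add_zero, mul_assoc]
    refine (norm_inner_le_norm _ _).trans (mul_le_mul_of_nonneg_left ?_ (norm_nonneg x))
    refine (hN z1 hz1).trans (mul_le_mul_of_nonneg_left ?_ hN0)
    have hproj : E.starProjection (y : H) = R z1 := by
      refine (Submodule.eq_starProjection_of_mem_orthogonal (hE _ hz1) ?_)
      rw [← hz, ← _root_.map_sub]
      exact hE' _ hz2
    rw [← hproj]
    exact Submodule.norm_starProjection_apply_le E _
  obtain ⟨z, hz⟩ : ∃ z, R z = x := ⟨_, hR' ⟨x, hxd⟩⟩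
  have hzE : z ∈ E := mem_of_resolvent_mem hinj hE hE' (by rwa [hz])
  subst hz
  refine ⟨hxd, ?_, ?_⟩
  · rw [hAR]
    exact E.add_mem hzE (E.smul_mem c hx)
  · rw [hAR]
    exact hN z hzE

/-- A self-adjoint operator is bounded on an increasing sequence of reducing subspaces whose
union is dense. -/
theorem IsSelfAdjointOp.exists_bounded_subspaces (hA : IsSelfAdjointOp A) :
    ∃ W : ℕ → Submodule ℂ H, Monotone W ∧ (∀ n, IsClosed (W n : Set H)) ∧
      (∀ x, (∀ n, x ∈ (W n)ᗮ) → x = 0) ∧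
      ∀ n, ∀ x ∈ W n, ∃ h : x ∈ A.domain, A ⟨x, h⟩ ∈ W n ∧ ‖A ⟨x, h⟩‖ ≤ n * ‖x‖ := by
  obtain ⟨R, hR, hR'⟩ := hA.exists_resolvent (c := Complex.I) (by simp) (by simp)
  obtain ⟨S, hS, hS'⟩ := hA.exists_resolvent (c := -Complex.I) (by simp) (by simp)
  have hadj : S = ContinuousLinearMap.adjoint R := by
    rw [ContinuousLinearMap.eq_adjoint_iff]
    intro x y
    obtain ⟨hx, hx2⟩ := hS x
    obtain ⟨hy, hy2⟩ := hR y
    have h := hA.inner_left ⟨S x, hx⟩ ⟨R y, hy⟩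
    nth_rw 1 [← hy2]
    nth_rw 2 [← hx2]
    simp only at h
    rw [inner_sub_left, inner_sub_right, h, inner_smul_left, inner_smul_right]
    simp
  have hcomm : Commute R (star R) := by
    change R * star R = star R * R
    rw [ContinuousLinearMap.star_eq_adjoint, ← hadj]
    ext z
    have key1 : R z - S z = (2 * Complex.I) • R (S z) := by
      obtain ⟨hx, hx2⟩ := hS z
      have := hR' ⟨S z, hx⟩
      have e : A ⟨S z, hx⟩ - Complex.I • S z = z - (2 * Complex.I) • S z := by
        rw [sub_eq_iff_eq_add.1 hx2]; module
      rw [e, _root_.map_sub, _root_.map_smul] at this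
      exact sub_eq_iff_eq_add.2 ((sub_eq_iff_eq_add.1 this).trans (add_comm _ _))
    have key2 : R z - S z = (2 * Complex.I) • S (R z) := by
      obtain ⟨hx, hx2⟩ := hR z
      have := hS' ⟨R z, hx⟩
      have e : A ⟨R z, hx⟩ - (-Complex.I) • R z = z + (2 * Complex.I) • R z := by
        rw [sub_eq_iff_eq_add.1 hx2]; module
      rw [e, _root_.map_add, _root_.map_smul] at this
      exact sub_eq_iff_eq_add'.2 this.symm
    have := key1.symm.trans key2
    exact smul_right_injective H (by simp : (2 * Complex.I) ≠ 0) this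
  set Q : H →L[ℂ] H := 1 + Complex.I • R with hQ
  have hAR : ∀ z, ∀ h : R z ∈ A.domain, A ⟨R z, h⟩ = Q z := fun z h => by
    rw [sub_eq_iff_eq_add.1 (hR z).2]; simp [hQ]
  set h : ℕ → H →L[ℂ] H := fun n => star Q * Q - ((n : ℂ) ^ 2) • (star R * R) with hh
  have hsa : ∀ n, IsSelfAdjoint (h n) := by
    intro n
    simp [hh, IsSelfAdjoint]
  have hRc : ∀ n, Commute (h n) R := by
    intro n
    have h1 : Commute Q R := by
      simp [hQ, Commute.add_left]
    have h2 : Commute (star Q) R := by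
      simp only [hQ, star_add, star_one, star_smul]
      exact (Commute.one_left _).add_left (hcomm.symm.smul_left _)
    exact (h2.mul_left h1).sub_left ((hcomm.symm.mul_left (Commute.refl R)).smul_left _)
  have hhc : ∀ n m, Commute (h n) (h m) := by
    intro n m
    have h1 : Commute (h n) Q := by
      exact (Commute.one_right _).add_right ((hRc n).smul_right _)
    have h2 : Commute (h n) (star Q) := by
      have := h1.star_star
      rwa [(hsa n).star_eq] at this
    have h3 : Commute (h n) (star R) := by
      have := (hRc n).star_star
      rwa [(hsa n).star_eq] at this
    exact (h2.mul_right h1).sub_right ((h3.mul_right (hRc n)).smul_right _)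
  have hform : ∀ n z, (inner ℂ (h n z) z).re = ‖Q z‖ ^ 2 - (n * ‖R z‖) ^ 2 := by
    intro n z
    simp only [hh, _root_.sub_apply, mul_apply_eq_comp,
      _root_.smul_apply, inner_sub_left, inner_smul_left,
      ContinuousLinearMap.star_eq_adjoint, ContinuousLinearMap.adjoint_inner_left,
      inner_self_eq_norm_sq_to_K]
    simp [← Complex.ofReal_pow, ← Complex.ofReal_mul, ← Complex.ofReal_natCast, mul_pow]
  have hle : ∀ n, ∀ z ∈ nonposSpace (h n), ‖Q z‖ ≤ n * ‖R z‖ := by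
    intro n z hz
    have := re_inner_nonpos_of_mem_nonposSpace (hsa n) hz
    rw [hform] at this
    exact (sq_le_sq₀ (norm_nonneg _) (by positivity)).1 (by linarith)
  have hge : ∀ n, ∀ z ∈ (nonposSpace (h n))ᗮ, n * ‖R z‖ ≤ ‖Q z‖ := by
    intro n z hz
    have := re_inner_nonneg_of_mem_orthogonal (hsa n) hz
    rw [hform] at this
    exact (sq_le_sq₀ (by positivity) (norm_nonneg _)).1 (by linarith)
  have hinj : Function.Injective R := by
    rw [injective_iff_map_eq_zero]
    intro z hz
    obtain ⟨h, h2⟩ := hR z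
    have : (⟨R z, h⟩ : A.domain) = 0 := Subtype.ext hz
    rw [this, hz, LinearPMap.map_zero] at h2
    simpa using h2.symm
  have hbdd : ∀ n, ∀ x ∈ nonposSpace (h n), ∃ hx : x ∈ A.domain,
      A ⟨x, hx⟩ ∈ nonposSpace (h n) ∧ ‖A ⟨x, hx⟩‖ ≤ n * ‖x‖ := fun n x hx =>
    hA.bounded_on_reducing hR hR' (fun x => nonposSpace_invariant (hRc n))
      (fun x => nonposSpace_orthogonal_invariant (hsa n) (hRc n)) (Nat.cast_nonneg n)
      (fun z hz => by simpa [hQ] using hle n z hz) hx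
  refine ⟨fun n => nonposSpace (h n), ?_, fun n => isClosed_nonposSpace _, ?_, hbdd⟩
  · refine monotone_nat_of_le_succ fun n x hx => ?_
    set m := n + 1
    set p := (nonposSpace (h m)).starProjection x with hp
    have hp1 : p ∈ nonposSpace (h n) := starProjection_nonposSpace_mem (hsa m) (hhc n m) hx
    have hq1 : x - p ∈ nonposSpace (h n) := Submodule.sub_mem _ hx hp1
    have hq2 : x - p ∈ (nonposSpace (h m))ᗮ := Submodule.sub_starProjection_mem_orthogonal _
    obtain ⟨hd, -, hb⟩ := hbdd n _ hq1
    obtain ⟨z, hz⟩ : ∃ z, R z = x - p := ⟨_, hR' ⟨x - p, hd⟩⟩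
    have hz2 : z ∈ (nonposSpace (h m))ᗮ := by
      refine mem_of_resolvent_mem hinj
        (fun x => nonposSpace_orthogonal_invariant (hsa m) (hRc m)) ?_ (by rwa [hz])
      rw [Submodule.orthogonal_orthogonal]
      exact fun x => nonposSpace_invariant (hRc m)
    have h1 := hge m z hz2
    have h2 : A ⟨x - p, hd⟩ = Q z := by
      rw [← hAR z (hR z).1]
      congr 1
      exact Subtype.ext hz.symm
    rw [h2] at hb
    rw [hz] at h1
    have h3 : ‖x - p‖ = 0 := by
      have : ((m : ℕ) : ℝ) = n + 1 := by simp [m]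
      rw [this] at h1
      nlinarith [norm_nonneg (x - p)]
    rw [sub_eq_zero.1 (norm_eq_zero.1 h3)]
    exact Submodule.starProjection_apply_mem _ _
  · intro x hx
    have h1 : ∀ n : ℕ, n * ‖R x‖ ≤ ‖Q x‖ := fun n => hge n x (hx n)
    by_contra hne
    have h2 : 0 < ‖R x‖ := norm_pos_iff.2 fun h => hne (hinj (h.trans R.map_zero.symm))
    obtain ⟨n, hn⟩ := exists_nat_gt (‖Q x‖ / ‖R x‖)
    rw [div_lt_iff₀ h2] at hn
    linarith [h1 n]

end Reducing

section AlmostInvariant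

variable {H : Type*} [NormedAddCommGroup H] [InnerProductSpace ℂ H]

theorem norm_apply_le_of_abs_re_inner_le {C : H →L[ℂ] H} (hC : (C : H →ₗ[ℂ] H).IsSymmetric)
    {W : Submodule ℂ H} (hW : ∀ x ∈ W, C x ∈ W) {δ : ℝ} (hδ : 0 < δ)
    (h : ∀ x ∈ W, |(inner ℂ (C x) x).re| ≤ δ * ‖x‖ ^ 2) {x : H} (hx : x ∈ W) :
    ‖C x‖ ≤ δ * ‖x‖ := by
  set t : ℂ := ((δ⁻¹ : ℝ) : ℂ) with ht
  have hy : t • C x ∈ W := W.smul_mem t (hW x hx)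
  have h1 := le_of_abs_le (h (x + t • C x) (W.add_mem hx hy))
  have h2 := neg_le_of_abs_le (h (x - t • C x) (W.sub_mem hx hy))
  have hs : inner ℂ (C (C x)) x = inner ℂ (C x) (C x) := hC (C x) x
  have hd : (inner ℂ (C (x + t • C x)) (x + t • C x)).re
      - (inner ℂ (C (x - t • C x)) (x - t • C x)).re = 4 * δ⁻¹ * ‖C x‖ ^ 2 := by
    rw [← Complex.sub_re]
    have : inner ℂ (C (x + t • C x)) (x + t • C x) - inner ℂ (C (x - t • C x)) (x - t • C x)
        = ((4 * δ⁻¹ * ‖C x‖ ^ 2 : ℝ) : ℂ) := by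
      simp only [_root_.map_add, _root_.map_sub, _root_.map_smul, inner_add_left, inner_sub_left,
        inner_add_right, inner_sub_right, inner_smul_left, inner_smul_right, hs, ht,
        Complex.conj_ofReal, inner_self_eq_norm_sq_to_K]
      push_cast
      simp only [Complex.coe_algebraMap]
      ring
    rw [this, Complex.ofReal_re]
  have hp := parallelogram_law_with_norm ℂ x (t • C x)
  have hn : ‖t • C x‖ = δ⁻¹ * ‖C x‖ := by
    rw [norm_smul, ht, Complex.norm_real, Real.norm_of_nonneg (by positivity)]
  have h3 : 4 * δ⁻¹ * ‖C x‖ ^ 2 ≤ δ * (2 * (‖x‖ * ‖x‖ + δ⁻¹ * ‖C x‖ * (δ⁻¹ * ‖C x‖))) := by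
    rw [← hd, ← hn]
    have : ‖x‖ * ‖x‖ + ‖t • C x‖ * ‖t • C x‖ = ‖x‖ ^ 2 + ‖t • C x‖ ^ 2 := by ring
    rw [this, ← hp]
    linarith
  have h4 : ‖C x‖ ^ 2 ≤ (δ * ‖x‖) ^ 2 := by
    have e : δ * δ⁻¹ = 1 := mul_inv_cancel₀ hδ.ne'
    have h5 := mul_le_mul_of_nonneg_left h3 hδ.le
    have e1 : δ * (4 * δ⁻¹ * ‖C x‖ ^ 2) = 4 * ‖C x‖ ^ 2 := by
      linear_combination (4 * ‖C x‖ ^ 2) * e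
    have e2 : δ * (δ * (2 * (‖x‖ * ‖x‖ + δ⁻¹ * ‖C x‖ * (δ⁻¹ * ‖C x‖))))
        = 2 * (δ * ‖x‖) ^ 2 + 2 * ‖C x‖ ^ 2 := by
      linear_combination (2 * ‖C x‖ ^ 2) * (δ * δ⁻¹ + 1) * e
    rw [e1, e2] at h5
    linarith
  exact (sq_le_sq₀ (norm_nonneg _) (by positivity)).1 h4

variable [CompleteSpace H]

theorem starProjection_nonposSpace_mem_of_invariant {B h : H →L[ℂ] H} (hB : IsSelfAdjoint B)
    (hBh : ∀ S : H →L[ℂ] H, Commute B S → Commute h S) (hh : IsSelfAdjoint h)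
    {W : Submodule ℂ H} [W.HasOrthogonalProjection]
    (hW : ∀ x ∈ W, B x ∈ W) {x : H} (hx : x ∈ W) :
    (nonposSpace h).starProjection x ∈ W := by
  have hW' : ∀ x ∈ Wᗮ, B x ∈ Wᗮ := by
    intro x hx
    rw [Submodule.mem_orthogonal] at hx ⊢
    intro u hu
    rw [← ContinuousLinearMap.adjoint_inner_left, ← ContinuousLinearMap.star_eq_adjoint,
      hB.star_eq]
    exact hx _ (hW u hu)
  have hcomm : Commute B W.starProjection := by
    ext z
    change B (W.starProjection z) = W.starProjection (B z)
    symm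
    refine Submodule.eq_starProjection_of_mem_orthogonal
      (hW _ (Submodule.starProjection_apply_mem W z)) ?_ |>.symm ▸ rfl
    rw [← _root_.map_sub]
    exact hW' _ (Submodule.sub_starProjection_mem_orthogonal z)
  have hc := hBh _ hcomm
  set p := (nonposSpace h).starProjection x
  have hp1 := nonposSpace_invariant hc (Submodule.starProjection_apply_mem (nonposSpace h) x)
  have hp2 := nonposSpace_orthogonal_invariant hh hc
    (Submodule.sub_starProjection_mem_orthogonal (K := nonposSpace h) x)
  rw [← Submodule.starProjection_eq_self_iff]
  rw [_root_.map_sub, Submodule.starProjection_eq_self_iff.2 hx] at hp2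
  exact (Submodule.eq_starProjection_of_mem_orthogonal hp1 hp2).symm

/-- Finite-dimensional subspaces are contained in almost invariant ones. -/
theorem exists_almost_invariant {B : H →L[ℂ] H} (hB : IsSelfAdjoint B) {ε : ℝ} (hε : 0 < ε)
    (n : ℕ) : ∀ (a : ℝ) (W : Submodule ℂ H), IsClosed (W : Set H) → (∀ x ∈ W, B x ∈ W) →
      (∀ x ∈ W, a * ‖x‖ ^ 2 ≤ (inner ℂ (B x) x).re) →
      (∀ x ∈ W, (inner ℂ (B x) x).re ≤ (a + n * ε) * ‖x‖ ^ 2) →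
      ∀ F : Submodule ℂ H, FiniteDimensional ℂ F → F ≤ W →
      ∃ G : Submodule ℂ H, FiniteDimensional ℂ G ∧ F ≤ G ∧ G ≤ W ∧
        ∀ g ∈ G, ∃ y ∈ G, ‖B g - y‖ ≤ ε * ‖g‖ := by
  have hshift : ∀ c : ℝ, IsSelfAdjoint (B - (c : ℂ) • (1 : H →L[ℂ] H)) := fun c => by
    simp [IsSelfAdjoint, hB.star_eq]
  have hinner : ∀ (c : ℝ) (x : H), (inner ℂ ((B - (c : ℂ) • (1 : H →L[ℂ] H)) x) x).re =
      (inner ℂ (B x) x).re - c * ‖x‖ ^ 2 := fun c x => by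
    simp only [_root_.sub_apply, _root_.smul_apply, one_apply_eq_self, inner_sub_left,
      inner_smul_left, Complex.conj_ofReal, inner_self_eq_norm_sq_to_K, Complex.sub_re]
    simp [← Complex.ofReal_pow]
  have hbase : ∀ (a : ℝ) (W : Submodule ℂ H), (∀ x ∈ W, B x ∈ W) →
      (∀ x ∈ W, a * ‖x‖ ^ 2 ≤ (inner ℂ (B x) x).re) →
      (∀ x ∈ W, (inner ℂ (B x) x).re ≤ (a + ε) * ‖x‖ ^ 2) →
      ∀ x ∈ W, ‖B x - ((a + ε / 2 : ℝ) : ℂ) • x‖ ≤ ε * ‖x‖ := by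
    intro a W hW h1 h2 x hx
    have := norm_apply_le_of_abs_re_inner_le
      (ContinuousLinearMap.isSelfAdjoint_iff_isSymmetric.1 (hshift (a + ε / 2))) (W := W)
      (fun x hx => W.sub_mem (hW x hx) (W.smul_mem _ hx)) (half_pos hε)
      (fun x hx => by
        rw [hinner, abs_le]
        have := h1 x hx
        have := h2 x hx
        constructor <;> nlinarith) hx
    refine le_trans this ?_
    nlinarith [norm_nonneg x]
  induction n with
  | zero =>
    intro a W _ hW h1 h2 F hF hFW
    refine ⟨F, hF, le_rfl, hFW, fun g hg => ⟨_, F.smul_mem ((a + ε / 2 : ℝ) : ℂ) hg, ?_⟩⟩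
    refine hbase a W hW h1 (fun x hx => (h2 x hx).trans ?_) g (hFW hg)
    push_cast
    nlinarith [sq_nonneg ‖x‖]
  | succ n ih =>
    intro a W hWc hW h1 h2 F hF hFW
    have : CompleteSpace W := hWc.completeSpace_coe
    set h := B - ((a + ε : ℝ) : ℂ) • (1 : H →L[ℂ] H) with hh
    have hsa : IsSelfAdjoint h := hshift _
    have hcs : ∀ S : H →L[ℂ] H, Commute B S → Commute h S := fun S hS =>
      hS.sub_left ((Commute.one_left _).smul_left _)
    have hBc : Commute h B := hcs B (Commute.refl B)
    set E := nonposSpace h with hE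
    have hPW : ∀ x ∈ W, E.starProjection x ∈ W := fun x hx =>
      starProjection_nonposSpace_mem_of_invariant hB hcs hsa hW hx
    set F₁ := F.map (E.starProjection : H →ₗ[ℂ] H)
    set F₂ := F.map ((1 - E.starProjection : H →L[ℂ] H) : H →ₗ[ℂ] H)
    have hF₁ : F₁ ≤ W ⊓ E := by
      rintro _ ⟨x, hx, rfl⟩
      exact ⟨hPW x (hFW hx), Submodule.starProjection_apply_mem E x⟩
    have hF₂ : F₂ ≤ W ⊓ Eᗮ := by
      rintro _ ⟨x, hx, rfl⟩
      exact ⟨W.sub_mem (hFW hx) (hPW x (hFW hx)), Submodule.sub_starProjection_mem_orthogonal x⟩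
    have hW₁ : ∀ x ∈ W ⊓ E, B x ∈ W ⊓ E := fun x hx =>
      ⟨hW x hx.1, nonposSpace_invariant hBc hx.2⟩
    have hW₂ : ∀ x ∈ W ⊓ Eᗮ, B x ∈ W ⊓ Eᗮ := fun x hx =>
      ⟨hW x hx.1, nonposSpace_orthogonal_invariant hsa hBc hx.2⟩
    obtain ⟨G₂, hG₂, hFG₂, hGW₂, hG₂'⟩ := ih (a + ε) (W ⊓ Eᗮ)
      (hWc.inter (Submodule.isClosed_orthogonal E)) hW₂
      (fun x hx => by
        have := re_inner_nonneg_of_mem_orthogonal hsa hx.2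
        rw [hh, hinner] at this
        linarith)
      (fun x hx => (h2 x hx.1).trans (le_of_eq (by push_cast; ring)))
      F₂ inferInstance hF₂
    have hG₁' : ∀ g ∈ F₁, ‖B g - ((a + ε / 2 : ℝ) : ℂ) • g‖ ≤ ε * ‖g‖ := fun g hg =>
      hbase a (W ⊓ E) hW₁ (fun x hx => h1 x hx.1)
        (fun x hx => by
          have := re_inner_nonpos_of_mem_nonposSpace hsa hx.2
          rw [hh, hinner] at this
          linarith) g (hF₁ hg)
    refine ⟨F₁ ⊔ G₂, inferInstance, fun x hx => ?_,
      sup_le (hF₁.trans inf_le_left) (hGW₂.trans inf_le_left), fun g hg => ?_⟩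
    · have : x = E.starProjection x + (x - E.starProjection x) := by abel
      rw [this]
      exact Submodule.add_mem_sup ⟨x, hx, rfl⟩ (hFG₂ ⟨x, hx, rfl⟩)
    · obtain ⟨g₁, hg₁, g₂, hg₂, rfl⟩ := Submodule.mem_sup.1 hg
      obtain ⟨y₂, hy₂, hb₂⟩ := hG₂' g₂ hg₂
      have hb₁ := hG₁' g₁ hg₁
      set y₁ := ((a + ε / 2 : ℝ) : ℂ) • g₁
      have hy₁ : y₁ ∈ F₁ := F₁.smul_mem _ hg₁
      refine ⟨y₁ + y₂, Submodule.add_mem_sup hy₁ hy₂, ?_⟩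
      have o1 : inner ℂ g₁ g₂ = 0 :=
        (Submodule.mem_orthogonal _ _).1 (hGW₂ hg₂).2 _ (hF₁ hg₁).2
      have o2 : inner ℂ (B g₁ - y₁) (B g₂ - y₂) = 0 :=
        (Submodule.mem_orthogonal _ _).1
          (Eᗮ.sub_mem (hW₂ _ (hGW₂ hg₂)).2 (hGW₂ hy₂).2) _
          (E.sub_mem (hW₁ _ (hF₁ hg₁)).2 (hF₁ hy₁).2)
      have e : B (g₁ + g₂) - (y₁ + y₂) = (B g₁ - y₁) + (B g₂ - y₂) := by
        rw [_root_.map_add]; abel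
      have p1 := norm_add_sq_eq_norm_sq_add_norm_sq_of_inner_eq_zero _ _ o1
      have p2 := norm_add_sq_eq_norm_sq_add_norm_sq_of_inner_eq_zero _ _ o2
      rw [e]
      refine (mul_self_le_mul_self_iff (norm_nonneg _) (by positivity)).2 ?_
      have q1 := mul_self_le_mul_self (norm_nonneg _) hb₁
      have q2 := mul_self_le_mul_self (norm_nonneg _) hb₂
      rw [p2]
      calc _ ≤ ε * ε * (‖g₁‖ * ‖g₁‖ + ‖g₂‖ * ‖g₂‖) := by linarith
        _ = _ := by rw [← p1]; ring

end AlmostInvariant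

section Quasidiagonal

variable {H : Type*} [NormedAddCommGroup H] [InnerProductSpace ℂ H] [CompleteSpace H]
  {A : H →ₗ.[ℂ] H}

theorem IsSelfAdjointOp.exists_almost_invariant_of_bounded (hA : IsSelfAdjointOp A)
    {W : Submodule ℂ H} (hWc : IsClosed (W : Set H)) (hle : W ≤ A.domain) {c : ℕ}
    (hW : ∀ x (hx : x ∈ W), A ⟨x, hle hx⟩ ∈ W)
    (hb : ∀ x (hx : x ∈ W), ‖A ⟨x, hle hx⟩‖ ≤ c * ‖x‖) {ε : ℝ} (hε : 0 < ε)
    {F : Submodule ℂ H} (hF : FiniteDimensional ℂ F) (hFW : F ≤ W) :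
    ∃ G : Submodule ℂ H, FiniteDimensional ℂ G ∧ F ≤ G ∧ G ≤ W ∧
      ∀ g : A.domain, (g : H) ∈ G → ∃ y ∈ G, ‖A g - y‖ ≤ ε * ‖(g : H)‖ := by
  have : CompleteSpace W := hWc.completeSpace_coe
  set T : W →L[ℂ] H := (A.toFun ∘ₗ Submodule.inclusion hle).mkContinuous c
    (fun x => hb x x.2) with hT
  set B : H →L[ℂ] H := T ∘L W.orthogonalProjectionOnto with hBdef
  have hT' : ∀ x : W, T x = A ⟨x, hle x.2⟩ := fun x => rfl
  have hBx : ∀ x (hx : x ∈ W), B x = A ⟨x, hle hx⟩ := fun x hx => by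
    change T (W.orthogonalProjectionOnto x) = _
    rw [hT']
    congr 2
    exact Submodule.starProjection_eq_self_iff.2 hx
  have hTW : ∀ x, T x ∈ W := fun x => hW x x.2
  have hB : IsSelfAdjoint B := by
    rw [ContinuousLinearMap.isSelfAdjoint_iff_isSymmetric]
    intro x y
    change inner ℂ (T (W.orthogonalProjectionOnto x)) y =
      inner ℂ x (T (W.orthogonalProjectionOnto y))
    have e1 : inner ℂ (T (W.orthogonalProjectionOnto x)) y =
        inner ℂ (T (W.orthogonalProjectionOnto x)) (W.orthogonalProjectionOnto y : H) :=
      (Submodule.inner_orthogonalProjectionOnto_eq_of_mem_left ⟨_, hTW _⟩ y).symm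
    have e2 : inner ℂ x (T (W.orthogonalProjectionOnto y)) =
        inner ℂ (W.orthogonalProjectionOnto x : H) (T (W.orthogonalProjectionOnto y)) :=
      (Submodule.inner_orthogonalProjectionOnto_eq_of_mem_right ⟨_, hTW _⟩ x).symm
    rw [e1, e2, hT', hT']
    exact hA.inner_left ⟨_, hle (W.orthogonalProjectionOnto x).2⟩
      ⟨_, hle (W.orthogonalProjectionOnto y).2⟩
  have hre : ∀ x ∈ W, |(inner ℂ (B x) x).re| ≤ c * ‖x‖ ^ 2 := fun x hx => by
    refine (Complex.abs_re_le_norm _).trans ((norm_inner_le_norm _ _).trans ?_)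
    rw [hBx x hx, sq, ← mul_assoc]
    exact mul_le_mul_of_nonneg_right (hb x hx) (norm_nonneg _)
  obtain ⟨n, hn⟩ := exists_nat_ge (2 * c / ε)
  rw [div_le_iff₀ hε] at hn
  obtain ⟨G, hG, hFG, hGW, h⟩ := exists_almost_invariant hB hε n (-c) W hWc
    (fun x hx => hBx x hx ▸ hW x hx)
    (fun x hx => by linarith [neg_le_of_abs_le (hre x hx)])
    (fun x hx => (le_of_abs_le (hre x hx)).trans
      (mul_le_mul_of_nonneg_right (by linarith) (sq_nonneg _))) F hF hFW
  refine ⟨G, hG, hFG, hGW, fun g hg => ?_⟩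
  have := h g hg
  rwa [hBx g (hGW hg)] at this

theorem IsSelfAdjointOp.exists_quasidiagonal [TopologicalSpace.SeparableSpace H]
    (hA : IsSelfAdjointOp A) :
    ∃ G : ℕ → Submodule ℂ H, Monotone G ∧ (∀ n, FiniteDimensional ℂ (G n)) ∧ G 0 = ⊥ ∧
      (∀ n, G n ≤ A.domain) ∧ (∀ x, (∀ n, x ∈ (G n)ᗮ) → x = 0) ∧
      ∀ n (x : A.domain), (x : H) ∈ G n → ∃ y ∈ G n, ‖A x - y‖ ≤ (1 / 2) ^ n * ‖(x : H)‖ := by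
  obtain ⟨W, hWm, hWc, hW0, hW⟩ := hA.exists_bounded_subspaces
  have hle : ∀ n, W n ≤ A.domain := fun n x hx => (hW n x hx).1
  have hS : Nonempty (⋃ n, (W n : Set H)) := ⟨0, Set.mem_iUnion.2 ⟨0, (W 0).zero_mem⟩⟩
  set v := TopologicalSpace.denseSeq (⋃ n, (W n : Set H)) with hv
  let State := {G : Submodule ℂ H // FiniteDimensional ℂ G ∧ ∃ N, G ≤ W N}
  have hstep : ∀ (n : ℕ) (s : State), ∃ t : State, s.1 ≤ t.1 ∧ (v n : H) ∈ t.1 ∧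
      ∀ x : A.domain, (x : H) ∈ t.1 →
        ∃ y ∈ t.1, ‖A x - y‖ ≤ (1 / 2) ^ (n + 1) * ‖(x : H)‖ := by
    rintro n ⟨F, hF, N, hFN⟩
    obtain ⟨N', hN'⟩ := Set.mem_iUnion.1 (v n).2
    have h1 : F ⊔ Submodule.span ℂ {(v n : H)} ≤ W (max N N') :=
      sup_le (hFN.trans (hWm (le_max_left _ _)))
        ((Submodule.span_singleton_le_iff_mem _ _).2 (hWm (le_max_right _ _) hN'))
    obtain ⟨G, hG, hFG, hGW, h⟩ := hA.exists_almost_invariant_of_bounded (hWc (max N N'))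
      (hle _) (fun x hx => (hW _ x hx).2.1) (fun x hx => (hW _ x hx).2.2)
      (ε := (1 / 2) ^ (n + 1)) (by positivity)
      (F := F ⊔ Submodule.span ℂ {(v n : H)}) inferInstance h1
    exact ⟨⟨G, hG, _, hGW⟩, le_sup_left.trans hFG,
      hFG (le_sup_right (a := F) (Submodule.mem_span_singleton_self _)), h⟩
  choose step hs1 hs2 hs3 using hstep
  let G : ℕ → State := fun n => Nat.rec ⟨⊥, inferInstance, 0, bot_le⟩ step n
  have hGs : ∀ n, G (n + 1) = step n (G n) := fun n => rfl
  refine ⟨fun n => (G n).1, monotone_nat_of_le_succ fun n => hs1 n (G n), fun n => (G n).2.1,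
    rfl, fun n => ?_, fun x hx => hW0 x fun N => ?_, fun n => ?_⟩
  · obtain ⟨N, hN⟩ := (G n).2.2
    exact hN.trans (hle N)
  · have hcl : IsClosed {y : (⋃ n, (W n : Set H)) | inner ℂ (y : H) x = 0} :=
      isClosed_eq (by fun_prop) continuous_const
    have hall : ∀ y : (⋃ n, (W n : Set H)), inner ℂ (y : H) x = 0 := by
      intro y
      refine hcl.closure_subset_iff.2 ?_ (TopologicalSpace.denseRange_denseSeq _ y)
      rintro _ ⟨n, rfl⟩
      exact (Submodule.mem_orthogonal _ _).1 (hx (n + 1)) _ (hs2 n (G n))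
    exact (Submodule.mem_orthogonal _ _).2 fun y hy => hall ⟨y, Set.mem_iUnion.2 ⟨N, hy⟩⟩
  · cases n with
    | zero =>
      intro x hx
      have hx0 : x = 0 := Subtype.ext ((Submodule.mem_bot ℂ).1 hx)
      exact ⟨0, Submodule.zero_mem _, by simp [hx0]⟩
    | succ n => exact hs3 n (G n)

end Quasidiagonal

section Diagonalization

variable {H : Type*} [NormedAddCommGroup H] [InnerProductSpace ℂ H] [CompleteSpace H]
  {A : H →ₗ.[ℂ] H}

/-- The operator `A` equals, on the Hilbert basis `e`, the diagonal operator with entries `a`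
up to the compact self-adjoint operator `K`. -/
structure IsDiagonalization (A : H →ₗ.[ℂ] H) (K : H →L[ℂ] H)
    (e : HilbertBasis ℕ ℂ H) (a : ℕ → ℝ) : Prop where
  isCompactOperator : IsCompactOperator K
  isSelfAdjoint : IsSelfAdjoint K
  mem_domain : ∀ n, e n ∈ A.domain
  apply_basis : ∀ n, A ⟨e n, mem_domain n⟩ = (a n : ℂ) • e n + K (e n)

theorem isCompactOperator_add_star_of_hasSum {C : ℕ → H →L[ℂ] H} {S : H →L[ℂ] H}
    (hS : HasSum C S)
    (hC : ∀ m, ∃ (V : Submodule ℂ H) (_ : FiniteDimensional ℂ V) (L : V →L[ℂ] H) (P : H →L[ℂ] V),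
      C m = L ∘L P) :
    IsCompactOperator (S + star S) := by
  have key : ∀ (D : ℕ → H →L[ℂ] H) (T : H →L[ℂ] H), HasSum D T →
      (∀ m, IsCompactOperator (D m)) → IsCompactOperator T := by
    intro D T hT hD
    refine isCompactOperator_of_tendsto hT.tendsto_sum_nat (Eventually.of_forall fun n => ?_)
    exact Submodule.sum_mem (compactOperator (RingHom.id ℂ) H H) fun i _ => hD i
  have h1 := key C S hS fun m => by
    obtain ⟨V, hV, L, P, h⟩ := hC m
    have := FiniteDimensional.proper ℂ V
    rw [h]
    exact (isCompactOperator_of_locallyCompactSpace_dom P).clm_comp L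
  have h2 := key (fun m => star (C m)) (star S) hS.star fun m => by
    obtain ⟨V, hV, L, P, h⟩ := hC m
    have := FiniteDimensional.proper ℂ V
    have : CompleteSpace V := FiniteDimensional.complete ℂ V
    rw [h, ContinuousLinearMap.star_eq_adjoint, ContinuousLinearMap.adjoint_comp]
    exact (isCompactOperator_of_locallyCompactSpace_dom
      (ContinuousLinearMap.adjoint L)).clm_comp (ContinuousLinearMap.adjoint P)
  exact h1.add h2

theorem IsSelfAdjointOp.exists_isDiagonalization [TopologicalSpace.SeparableSpace H]
    (hdim : ¬ FiniteDimensional ℂ H) (hA : IsSelfAdjointOp A) :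
    ∃ (K : H →L[ℂ] H) (e : HilbertBasis ℕ ℂ H) (a : ℕ → ℝ), IsDiagonalization A K e a := by
  obtain ⟨G, hGm, hGf, hG0, hGd, hGt, hG⟩ := hA.exists_quasidiagonal
  let V : ℕ → Submodule ℂ H := fun n => G (n + 1) ⊓ (G n)ᗮ
  have hVf : ∀ n, FiniteDimensional ℂ (V n) := fun n =>
    Submodule.finiteDimensional_of_le inf_le_left
  have hVd : ∀ n, V n ≤ A.domain := fun n => inf_le_left.trans (hGd _)
  have hV : ∀ {m n}, m < n → ∀ x ∈ V m, ∀ y ∈ V n, inner ℂ x y = 0 := fun {m n} hmn x hx y hy =>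
    (Submodule.mem_orthogonal _ _).1 hy.2 x (hGm (Nat.succ_le_of_lt hmn) hx.1)
  have hV' : ∀ {m n}, m ≠ n → ∀ x ∈ V m, ∀ y ∈ V n, inner ℂ x y = 0 := fun {m n} hmn x hx y hy =>
    hmn.lt_or_gt.elim (fun h => hV h x hx y hy)
      fun h => inner_eq_zero_symm.1 (hV h y hy x hx)
  have hVt : ∀ x, (∀ n, ∀ y ∈ V n, inner ℂ y x = 0) → x = 0 := by
    intro x hx
    refine hGt x fun n => ?_
    induction n with
    | zero => rw [hG0]; simp
    | succ n ih =>
      refine (Submodule.mem_orthogonal _ _).2 fun y hy => ?_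
      have h1 : (G n).starProjection y ∈ G n := Submodule.starProjection_apply_mem _ y
      have h2 := hx n (y - (G n).starProjection y)
        ⟨Submodule.sub_mem _ hy (hGm n.le_succ h1), Submodule.sub_starProjection_mem_orthogonal y⟩
      rw [inner_sub_left, (Submodule.mem_orthogonal _ _).1 ih _ h1, sub_zero] at h2
      exact h2
  let T : ∀ n, V n →ₗ[ℂ] H := fun n => A.toFun ∘ₗ Submodule.inclusion (hVd n)
  have hT : ∀ n (x : V n), T n x = A ⟨x, hVd n x.2⟩ := fun n x => rfl
  let L : ∀ n, V n →L[ℂ] H := fun n =>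
    (1 - (G (n + 1)).starProjection) ∘L LinearMap.toContinuousLinearMap (T n)
  let C : ℕ → H →L[ℂ] H := fun n => L n ∘L (V n).orthogonalProjectionOnto
  have hL : ∀ n (x : V n), L n x = T n x - (G (n + 1)).starProjection (T n x) := fun n x => rfl
  have hLn : ∀ n (x : V n), ‖L n x‖ ≤ (1 / 2) ^ (n + 1) * ‖x‖ := by
    intro n x
    obtain ⟨y, hy, hyb⟩ := hG (n + 1) ⟨x, hVd n x.2⟩ x.2.1
    rw [hL, Submodule.starProjection_minimal]
    exact (ciInf_le (f := fun z : G (n + 1) => ‖T n x - z‖)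
      ⟨0, by rintro _ ⟨z, rfl⟩; exact norm_nonneg _⟩ ⟨y, hy⟩).trans hyb
  have hCn : ∀ n, ‖C n‖ ≤ (1 / 2) ^ (n + 1) := by
    intro n
    refine (ContinuousLinearMap.opNorm_comp_le _ _).trans ?_
    have h1 := ContinuousLinearMap.opNorm_le_bound (L n) (by positivity) (hLn n)
    calc _ ≤ (1 / 2 : ℝ) ^ (n + 1) * 1 :=
          mul_le_mul h1 (V n).orthogonalProjectionOnto_norm_le
            (norm_nonneg (V n).orthogonalProjectionOnto) (by positivity)
      _ = _ := mul_one _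
  have hsum : Summable C := Summable.of_norm_bounded
    ((summable_nat_add_iff 1).2 summable_geometric_two) hCn
  obtain ⟨S, hS⟩ := hsum
  have hSV : ∀ n x (hx : x ∈ V n), S x = L n ⟨x, hx⟩ := by
    intro n x hx
    have h1 : HasSum (fun m => C m x) (S x) :=
      hS.mapL (ContinuousLinearMap.apply ℂ H x)
    have h2 : C n x = L n ⟨x, hx⟩ := by
      change L n ((V n).orthogonalProjectionOnto x) = _
      congr 1
      exact Subtype.ext (Submodule.starProjection_eq_self_iff.2 hx)
    rw [← h2]
    refine h1.unique (hasSum_single n fun m hm => ?_)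
    change L m ((V m).orthogonalProjectionOnto x) = 0
    rw [Submodule.orthogonalProjectionOnto_eq_zero_iff.2, _root_.map_zero]
    exact (Submodule.mem_orthogonal _ _).2 fun y hy => hV' hm y hy x hx
  have hLi : ∀ n (x : V n) z, inner ℂ z (L n x) =
      inner ℂ (z - (G (n + 1)).starProjection z) (T n x) := by
    intro n x z
    rw [hL, inner_sub_right, inner_sub_left, Submodule.inner_starProjection_left_eq_right]
  have hK : ∀ n x (hx : x ∈ V n) j z (_ : z ∈ V j), inner ℂ z ((S + star S) x) =
      if j = n then 0 else inner ℂ z (T n ⟨x, hx⟩) := by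
    intro n x hx j z hz
    have e0 : inner ℂ z ((S + star S) x) = inner ℂ z (S x) + inner ℂ (S z) x := by
      rw [_root_.add_apply, inner_add_right, ContinuousLinearMap.star_eq_adjoint,
        ContinuousLinearMap.adjoint_inner_right]
    have hmem : ∀ {i k} {w : H}, w ∈ V i → i ≤ k → w - (G (k + 1)).starProjection w = 0 :=
      fun {i k w} hw hik => by
        rw [Submodule.starProjection_eq_self_iff.2 (hGm (Nat.succ_le_succ hik) hw.1), sub_self]
    have horth : ∀ {i k} {w : H}, w ∈ V i → k < i → w - (G (k + 1)).starProjection w = w :=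
      fun {i k w} hw hik => by
        rw [(Submodule.starProjection_apply_eq_zero_iff _).2
          (Submodule.orthogonal_le (hGm (Nat.succ_le_of_lt hik)) hw.2), sub_zero]
    rw [e0, hSV n x hx, hSV j z hz, hLi, ← inner_conj_symm (L j _) x, hLi]
    rcases lt_trichotomy j n with h | h | h
    · rw [hmem hz h.le, horth hx h, if_neg h.ne, inner_zero_left, zero_add,
        inner_conj_symm]
      exact hA.inner_left ⟨z, hVd j hz⟩ ⟨x, hVd n hx⟩
    · subst h
      rw [hmem hz le_rfl, hmem hx le_rfl]
      simp
    · rw [horth hz h, hmem hx h.le, if_neg h.ne']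
      simp
  let R : ∀ n, V n →ₗ[ℂ] V n := fun n => ((V n).orthogonalProjectionOnto : H →ₗ[ℂ] V n) ∘ₗ T n
  have hRi : ∀ n (x y : V n), inner ℂ (y : H) (T n x) = inner ℂ y (R n x) := fun n x y =>
    (Submodule.inner_orthogonalProjectionOnto_eq_of_mem_left y (T n x)).symm
  have hR : ∀ n, (R n).IsSymmetric := by
    intro n x y
    rw [← hRi, ← inner_conj_symm, ← hRi, inner_conj_symm]
    exact hA.inner_left ⟨x, hVd n x.2⟩ ⟨y, hVd n y.2⟩
  let b : ∀ n, OrthonormalBasis (Fin (Module.finrank ℂ (V n))) ℂ (V n) := fun n =>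
    (hR n).eigenvectorBasis rfl
  let ι := Σ n, Fin (Module.finrank ℂ (V n))
  let e : ι → H := fun i => b i.1 i.2
  have heo : Orthonormal ℂ e :=
    OrthogonalFamily.orthonormal_sigma_orthonormal (V := fun n => (V n).subtypeₗᵢ)
      (fun i j hij v w => hV' hij v v.2 w w.2) fun n => (b n).orthonormal
  have het : (Submodule.span ℂ (Set.range e))ᗮ = ⊥ := by
    rw [eq_bot_iff]
    intro x hx
    refine hVt x fun n y hy => ?_
    refine (Submodule.mem_orthogonal _ _).1 hx y ?_
    have h1 : (⟨y, hy⟩ : V n) = ∑ i, (b n).repr ⟨y, hy⟩ i • b n i := ((b n).sum_repr _).symm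
    have h2 := congrArg (V n).subtype h1
    rw [map_sum] at h2
    change y = _ at h2
    rw [h2]
    exact Submodule.sum_mem _ fun i _ =>
      Submodule.smul_mem _ _ (Submodule.subset_span ⟨⟨n, i⟩, rfl⟩)
  have hinf : Infinite ι := by
    by_contra hfin
    rw [not_infinite_iff_finite] at hfin
    have h1 : FiniteDimensional ℂ (Submodule.span ℂ (Set.range e)) :=
      FiniteDimensional.span_of_finite ℂ (Set.finite_range e)
    rw [Submodule.orthogonal_eq_bot_iff] at het
    rw [het] at h1
    exact hdim (Module.finite_def.2 (Module.Finite.iff_fg.1 h1))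
  obtain ⟨_⟩ := nonempty_denumerable ι
  let φ := (Denumerable.eqv ι).symm
  have heo' : Orthonormal ℂ (e ∘ φ) := heo.comp _ φ.injective
  have het' : (Submodule.span ℂ (Set.range (e ∘ φ)))ᗮ = ⊥ := by
    rwa [φ.surjective.range_comp]
  have hVb : ∀ k, (b (φ k).1 (φ k).2 : H) ∈ A.domain := fun k => hVd _ (b (φ k).1 (φ k).2).2
  have hcoe : ⇑(HilbertBasis.mkOfOrthogonalEqBot heo' het') = e ∘ φ :=
    HilbertBasis.coe_mkOfOrthogonalEqBot heo' het'
  refine ⟨S + star S, HilbertBasis.mkOfOrthogonalEqBot heo' het',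
    fun k => (hR (φ k).1).eigenvalues rfl (φ k).2,
    isCompactOperator_add_star_of_hasSum hS fun m => ⟨V m, hVf m, L m, _, rfl⟩,
    IsSelfAdjoint.add_star_self S, fun k => by rw [hcoe]; exact hVb k, fun k => ?_⟩
  simp only [hcoe]
  set i := φ k with hi
  have hei : (e ∘ φ) k = b i.1 i.2 := rfl
  simp only [hei]
  rw [← sub_eq_zero]
  refine hVt _ fun j z hz => ?_
  rw [← hT, inner_sub_right, inner_add_right, hK _ _ (b i.1 i.2).2 j z hz, inner_smul_right]
  split_ifs with h
  · subst h
    have h1 := hRi i.1 (b i.1 i.2) ⟨z, hz⟩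
    rw [(hR i.1).apply_eigenvectorBasis rfl i.2, inner_smul_right] at h1
    rw [h1, add_zero]
    exact sub_self _
  · rw [hV' h z hz _ (b i.1 i.2).2]
    simp

end Diagonalization

section Consequences

variable {H : Type*} [NormedAddCommGroup H] [InnerProductSpace ℂ H]

theorem HilbertBasis.hasSum_norm_inner_sq (e : HilbertBasis ℕ ℂ H) (x : H) :
    HasSum (fun n => ‖inner ℂ (e n) x‖ ^ 2) (‖x‖ ^ 2) := by
  have h := (e.hasSum_inner_mul_inner x x).mapL Complex.reCLM
  have e1 : Complex.reCLM (inner ℂ x x) = ‖x‖ ^ 2 := by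
    rw [inner_self_eq_norm_sq_to_K]
    simp [← Complex.ofReal_pow]
  rw [e1] at h
  have e2 : (fun n => ‖inner ℂ (e n) x‖ ^ 2) =
      fun n => Complex.reCLM (inner ℂ x (e n) * inner ℂ (e n) x) := by
    ext n
    rw [← inner_conj_symm x, Complex.conj_mul']
    simp [← Complex.ofReal_pow]
  rw [e2]
  exact h

theorem HilbertBasis.ext_inner (e : HilbertBasis ℕ ℂ H) {x y : H}
    (h : ∀ n, inner ℂ (e n) x = inner ℂ (e n) y) : x = y := by
  refine e.repr.injective (Subtype.ext (funext fun n => ?_))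
  rw [e.repr_apply_apply, e.repr_apply_apply, h]

theorem Orthonormal.tendsto_inner_zero {x : ℕ → H} (hx : Orthonormal ℂ x) (y : H) :
    Tendsto (fun k => inner ℂ (x k) y) atTop (𝓝 0) := by
  have h := (hx.inner_products_summable y).tendsto_atTop_zero
  rw [tendsto_zero_iff_norm_tendsto_zero]
  have := h.sqrt
  simpa [Real.sqrt_sq] using this

variable [CompleteSpace H] {A : H →ₗ.[ℂ] H} {K : H →L[ℂ] H} {e : HilbertBasis ℕ ℂ H} {a : ℕ → ℝ}

theorem IsCompactOperator.tendsto_apply_orthonormal (hK : IsCompactOperator K) {x : ℕ → H}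
    (hx : Orthonormal ℂ x) : Tendsto (fun k => K (x k)) atTop (𝓝 0) := by
  refine tendsto_of_subseq_tendsto fun ns hns => ?_
  have hc := hK.isCompact_closure_image_closedBall (f := (K : H →ₗ[ℂ] H)) 1
  obtain ⟨y, -, φ, hφ, hy⟩ := hc.tendsto_subseq (x := fun k => K (x (ns k))) fun k =>
    subset_closure ⟨x (ns k), by simp [hx.1], rfl⟩
  refine ⟨φ, ?_⟩
  have h1 : Tendsto (fun k => inner ℂ (K (x (ns (φ k)))) y) atTop (𝓝 (inner ℂ y y)) :=
    Tendsto.inner hy tendsto_const_nhds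
  have h2 : Tendsto (fun k => inner ℂ (K (x (ns (φ k)))) y) atTop (𝓝 0) := by
    simp_rw [← ContinuousLinearMap.adjoint_inner_right]
    exact (hx.tendsto_inner_zero _).comp (hns.comp hφ.tendsto_atTop)
  have h3 : y = 0 := inner_self_eq_zero.1 (tendsto_nhds_unique h1 h2)
  rw [h3] at hy
  exact hy

namespace IsDiagonalization

theorem inner_apply (hA : IsSelfAdjointOp A) (hD : IsDiagonalization A K e a) (x : A.domain)
    (n : ℕ) : inner ℂ (e n) (A x - K x) = a n * inner ℂ (e n) (x : H) := by
  have h := hA.inner_left ⟨e n, hD.mem_domain n⟩ x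
  rw [hD.apply_basis, inner_add_left, inner_smul_left, Complex.conj_ofReal] at h
  rw [inner_sub_right, ← h, ← ContinuousLinearMap.adjoint_inner_left,
    ← ContinuousLinearMap.star_eq_adjoint, hD.isSelfAdjoint.star_eq]
  ring

theorem mem_domain_iff (hA : IsSelfAdjointOp A) (hD : IsDiagonalization A K e a) {x : H} :
    x ∈ A.domain ↔ Memℓp (fun n => (a n : ℂ) * inner ℂ (e n) x) 2 := by
  constructor
  · intro hx
    have h : (fun n => (a n : ℂ) * inner ℂ (e n) x) = e.repr (A ⟨x, hx⟩ - K x) := by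
      ext n
      rw [e.repr_apply_apply, inner_apply hA hD ⟨x, hx⟩]
    rw [h]
    exact lp.memℓp _
  · intro h
    set w := e.repr.symm ⟨_, h⟩ with hw
    have hwn : ∀ n, inner ℂ (e n) w = a n * inner ℂ (e n) x := fun n => by
      rw [← e.repr_apply_apply, hw, LinearIsometryEquiv.apply_symm_apply]
    refine hA.mem_domain_of_inner (w := w + K x) fun y => ?_
    have e1 : inner ℂ w (y : H) = inner ℂ x (A y - K y) := by
      rw [← e.tsum_inner_mul_inner, ← e.tsum_inner_mul_inner]
      congr 1 with n
      rw [inner_apply hA hD, ← inner_conj_symm, hwn, ← inner_conj_symm x, map_mul,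
        Complex.conj_ofReal]
      ring
    rw [inner_add_left, e1, inner_sub_right, ← ContinuousLinearMap.adjoint_inner_left,
      ← ContinuousLinearMap.star_eq_adjoint, hD.isSelfAdjoint.star_eq]
    ring

theorem mem_essSpec_iff (hA : IsSelfAdjointOp A) (hD : IsDiagonalization A K e a) {t : ℝ} :
    t ∈ essSpec A ↔ ∀ ε > 0, ∃ᶠ n in atTop, |a n - t| < ε := by
  constructor
  · rintro ⟨x, hxo, hx⟩ ε hε hfreq
    obtain ⟨N, hN⟩ := eventually_atTop.1 hfreq
    simp only [not_lt] at hN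
    set y : ℕ → H := fun k => A (x k) - K (x k) - (t : ℂ) • (x k : H) with hy
    have hy0 : Tendsto (fun k => ‖y k‖) atTop (𝓝 0) := by
      rw [← tendsto_zero_iff_norm_tendsto_zero]
      have h1 := tendsto_zero_iff_norm_tendsto_zero.2 hx
      have h2 := h1.sub (hD.isCompactOperator.tendsto_apply_orthonormal hxo)
      rw [sub_zero] at h2
      exact h2.congr fun k => sub_right_comm _ _ _
    have hyn : ∀ k n, inner ℂ (e n) (y k) = ((a n - t : ℝ) : ℂ) * inner ℂ (e n) (x k : H) := by
      intro k n
      rw [hy, inner_sub_right, inner_apply hA hD, inner_smul_right]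
      push_cast
      ring
    have hbound : ∀ k, 1 ≤ ∑ n ∈ Finset.range N, ‖inner ℂ (x k : H) (e n)‖ ^ 2 +
        (ε⁻¹) ^ 2 * ‖y k‖ ^ 2 := by
      intro k
      have h1 := e.hasSum_norm_inner_sq (x k : H)
      have h2 := (e.hasSum_norm_inner_sq (y k)).mul_left ((ε⁻¹) ^ 2)
      have h3 : HasSum (fun n => if n ∈ Finset.range N then ‖inner ℂ (x k : H) (e n)‖ ^ 2 else 0)
          (∑ n ∈ Finset.range N, ‖inner ℂ (x k : H) (e n)‖ ^ 2) := by
        have := hasSum_sum_of_ne_finset_zero (s := Finset.range N) (L := .unconditional ℕ)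
          (f := fun n => if n ∈ Finset.range N then ‖inner ℂ (x k : H) (e n)‖ ^ 2 else 0)
          (fun n hn => if_neg hn)
        rwa [Finset.sum_congr rfl fun n hn => if_pos hn] at this
      have h4 := hasSum_le (fun n => ?_) h1 (h3.add h2)
      · rwa [hxo.1 k, one_pow] at h4
      · split_ifs with hn
        · rw [norm_inner_symm]
          have : 0 ≤ (ε⁻¹) ^ 2 * ‖inner ℂ (e n) (y k)‖ ^ 2 := by positivity
          linarith
        · rw [Finset.mem_range, not_lt] at hn
          rw [zero_add, hyn, norm_mul, Complex.norm_real, ← mul_pow, ← mul_assoc,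
            Real.norm_eq_abs]
          refine pow_le_pow_left₀ (norm_nonneg _) (le_mul_of_one_le_left (norm_nonneg _) ?_) 2
          rw [inv_mul_eq_div, one_le_div hε]
          exact hN n hn
    have hlim : Tendsto (fun k => ∑ n ∈ Finset.range N, ‖inner ℂ (x k : H) (e n)‖ ^ 2 +
        (ε⁻¹) ^ 2 * ‖y k‖ ^ 2) atTop (𝓝 0) := by
      have h1 : Tendsto (fun k => ∑ n ∈ Finset.range N, ‖inner ℂ (x k : H) (e n)‖ ^ 2) atTop
          (𝓝 (∑ n ∈ Finset.range N, ‖(0 : ℂ)‖ ^ 2)) :=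
        tendsto_finsetSum _ fun n _ => ((hxo.tendsto_inner_zero (e n)).norm.pow 2)
      have h2 := (hy0.pow 2).const_mul ((ε⁻¹) ^ 2)
      simpa using h1.add h2
    linarith [ge_of_tendsto' hlim hbound]
  · intro h
    obtain ⟨φ, hφ, hφt⟩ := extraction_forall_of_frequently
      (P := fun k n => |a n - t| < 1 / ((k : ℝ) + 1)) fun k => h _ (by positivity)
    have ho : Orthonormal ℂ (fun k => e (φ k)) := e.orthonormal.comp _ hφ.injective
    refine ⟨fun k => ⟨e (φ k), hD.mem_domain _⟩, ho, ?_⟩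
    have h1 := (hD.isCompactOperator.tendsto_apply_orthonormal ho).norm
    rw [norm_zero] at h1
    have h2 := tendsto_one_div_add_atTop_nhds_zero_nat (𝕜 := ℝ) |>.add h1
    rw [zero_add] at h2
    refine squeeze_zero (fun k => norm_nonneg _) (fun k => ?_) h2
    have h3 : A ⟨e (φ k), hD.mem_domain _⟩ - (t : ℂ) • e (φ k) =
        ((a (φ k) - t : ℝ) : ℂ) • e (φ k) + K (e (φ k)) := by
      rw [hD.apply_basis]
      push_cast
      rw [sub_smul]
      abel
    rw [h3]
    refine (norm_add_le _ _).trans (add_le_add_left ?_ _)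
    rw [norm_smul, e.orthonormal.1, mul_one, Complex.norm_real]
    exact (hφt k).le

end IsDiagonalization

end Consequences

section Matching

theorem NoLargeHoles.tendsto_infDist {M : Set ℝ} (hM : NoLargeHoles M) {a : ℕ → ℝ}
    (ha : ∀ t, (∀ ε > 0, ∃ᶠ n in atTop, |a n - t| < ε) → t ∈ M) :
    Tendsto (fun n => infDist (a n) M) atTop (𝓝 0) := by
  rw [Metric.tendsto_atTop']
  intro ε hε
  by_contra hcon
  obtain ⟨N, hN, hNM⟩ := hM.2 ε hε
  have hfreq : ∃ᶠ n in atTop, a n ∈ Set.Icc (-N) N ∩ {s | ε ≤ infDist s M} := by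
    rw [frequently_atTop']
    intro k
    push Not at hcon
    obtain ⟨n, hn, hd⟩ := hcon k
    rw [Real.dist_0_eq_abs, abs_of_nonneg infDist_nonneg] at hd
    refine ⟨n, hn, abs_le.1 (not_lt.1 fun h => ?_), hd⟩
    refine absurd (hNM (a n) (fun h => ?_) h) (not_lt.2 hd)
    rw [infDist_zero_of_mem h] at hd
    exact absurd hd (not_le.2 hε)
  have hc : IsCompact (Set.Icc (-N) N ∩ {s | ε ≤ infDist s M}) :=
    isCompact_Icc.inter_right (isClosed_le continuous_const (continuous_infDist_pt M))
  obtain ⟨t, ht, φ, hφ, hlim⟩ := hc.tendsto_subseq' hfreq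
  have htM : t ∈ M := ha t fun δ hδ => by
    refine hφ.tendsto_atTop.frequently (p := fun n => |a n - t| < δ) (Eventually.frequently ?_)
    exact (Metric.tendsto_nhds.1 hlim) δ hδ
  have h2 : ε ≤ infDist t M := ht.2
  rw [infDist_zero_of_mem htM] at h2
  exact absurd h2 (not_le.2 hε)

theorem NoLargeHoles.exists_approximating_subsequence {M : Set ℝ} (hM : NoLargeHoles M)
    {a b : ℕ → ℝ} (ha : ∀ t, (∀ ε > 0, ∃ᶠ n in atTop, |a n - t| < ε) → t ∈ M)
    (hb : ∀ t ∈ M, ∀ ε > 0, ∃ᶠ n in atTop, |b n - t| < ε) :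
    ∃ (φ : ℕ → ℕ) (δ : ℕ → ℝ), StrictMono φ ∧ (∀ n, 0 < δ n) ∧ Tendsto δ atTop (𝓝 0) ∧
      ∀ n, |a n - b (φ n)| < δ n := by
  set η : ℕ → ℝ := fun n => 1 / ((n : ℝ) + 1)
  have hη : ∀ n, 0 < η n := fun n => by positivity
  have hη0 : Tendsto η atTop (𝓝 0) := tendsto_one_div_add_atTop_nhds_zero_nat
  set δ : ℕ → ℝ := fun n => infDist (a n) M + η n + η n with hδ
  have hδ0 : Tendsto δ atTop (𝓝 0) := by
    simpa using ((hM.tendsto_infDist ha).add hη0).add hη0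
  have hP : ∀ n, ∃ᶠ k in atTop, |a n - b k| < δ n := by
    intro n
    obtain ⟨t, ht, hd⟩ := (infDist_lt_iff hM.1).1 (lt_add_of_pos_right (infDist (a n) M) (hη n))
    refine (hb t ht (η n) (hη n)).mono fun k hk => ?_
    rw [Real.dist_eq] at hd
    rw [abs_sub_comm] at hk
    calc |a n - b k| ≤ |a n - t| + |t - b k| := abs_sub_le _ _ _
      _ < _ := add_lt_add hd hk
  obtain ⟨φ, hφ, h⟩ := extraction_forall_of_frequently hP
  exact ⟨φ, δ, hφ, fun n => add_pos (add_pos_of_nonneg_of_pos infDist_nonneg (hη n)) (hη n),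
    hδ0, h⟩

theorem NoLargeHoles.exists_matching {M : Set ℝ} (hM : NoLargeHoles M) {a b : ℕ → ℝ}
    (ha : ∀ t, t ∈ M ↔ ∀ ε > 0, ∃ᶠ n in atTop, |a n - t| < ε)
    (hb : ∀ t, t ∈ M ↔ ∀ ε > 0, ∃ᶠ n in atTop, |b n - t| < ε) :
    ∃ π : ℕ ≃ ℕ, Tendsto (fun n => b (π n) - a n) atTop (𝓝 0) := by
  obtain ⟨f, δ, hf, hδp, hδ, hfδ⟩ := hM.exists_approximating_subsequence
    (fun t => (ha t).2) fun t => (hb t).1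
  obtain ⟨g, η, hg, hηp, hη, hgη⟩ := hM.exists_approximating_subsequence
    (fun t => (hb t).2) fun t => (ha t).1
  obtain ⟨h, hh, hR⟩ := Function.Embedding.schroeder_bernstein_of_rel hf.injective hg.injective
    (fun n k => |a n - b k| < δ n ∨ |a n - b k| < η k) (fun n => Or.inl (hfδ n))
    (fun k => Or.inr (by rw [abs_sub_comm]; exact hgη k))
  refine ⟨Equiv.ofBijective h hh, ?_⟩
  have hh' : Tendsto h atTop atTop := by
    have := hh.1.tendsto_cofinite
    rwa [Nat.cofinite_eq_atTop] at this
  have hlim := hδ.add (hη.comp hh')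
  rw [add_zero] at hlim
  refine squeeze_zero_norm (fun n => ?_) hlim
  rw [Real.norm_eq_abs, abs_sub_comm]
  change |a n - b (h n)| ≤ δ n + η (h n)
  rcases hR n with h1 | h1
  · linarith [hηp (h n)]
  · linarith [hδp n]

end Matching

section Equivalence

variable {H : Type*} [NormedAddCommGroup H] [InnerProductSpace ℂ H]

theorem HilbertBasis.norm_le_of_norm_inner_le (e : HilbertBasis ℕ ℂ H) {x y : H} {C : ℝ}
    (hC : 0 ≤ C) (h : ∀ n, ‖inner ℂ (e n) y‖ ≤ C * ‖inner ℂ (e n) x‖) : ‖y‖ ≤ C * ‖x‖ := by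
  refine (sq_le_sq₀ (norm_nonneg _) (by positivity)).1 ?_
  rw [mul_pow]
  refine hasSum_le (fun n => ?_) (e.hasSum_norm_inner_sq y)
    ((e.hasSum_norm_inner_sq x).mul_left (C ^ 2))
  rw [← mul_pow]
  exact pow_le_pow_left₀ (norm_nonneg _) (h n) 2

variable [CompleteSpace H]

theorem HilbertBasis.exists_reindex (e : HilbertBasis ℕ ℂ H) (π : ℕ ≃ ℕ) :
    ∃ e' : HilbertBasis ℕ ℂ H, ∀ n, e' n = e (π n) := by
  have ho : Orthonormal ℂ (e ∘ π) := e.orthonormal.comp _ π.injective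
  have ht : (Submodule.span ℂ (Set.range (e ∘ π)))ᗮ = ⊥ := by
    rw [π.surjective.range_comp, ← Submodule.topologicalClosure_eq_top_iff]
    exact e.dense_span
  exact ⟨HilbertBasis.mkOfOrthogonalEqBot ho ht,
    fun n => congrFun (HilbertBasis.coe_mkOfOrthogonalEqBot ho ht) n⟩

/-- Diagonal operators whose entries tend to zero are compact. -/
theorem HilbertBasis.exists_compact_diagonal (e : HilbertBasis ℕ ℂ H) {c : ℕ → ℝ}
    (hc : Tendsto c atTop (𝓝 0)) :
    ∃ E : H →L[ℂ] H, IsCompactOperator E ∧ IsSelfAdjoint E ∧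
      ∀ x n, inner ℂ (e n) (E x) = c n * inner ℂ (e n) x := by
  obtain ⟨C, hC⟩ := hc.norm.bddAbove_range
  have hC' : ∀ n, ‖c n‖ ≤ C := fun n => hC ⟨n, rfl⟩
  have hC0 : 0 ≤ C := (norm_nonneg _).trans (hC' 0)
  let T : ℕ → ℂ →L[ℂ] ℂ := fun n => (c n : ℂ) • ContinuousLinearMap.id ℂ ℂ
  have hT : ∀ n, ‖T n‖ ≤ C := fun n => by
    refine ContinuousLinearMap.opNorm_le_bound _ hC0 fun z => ?_
    change ‖(c n : ℂ) * z‖ ≤ _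
    rw [norm_mul, Complex.norm_real]
    exact mul_le_mul_of_nonneg_right (hC' n) (norm_nonneg _)
  let D : H →L[ℂ] H := (e.repr.symm.toContinuousLinearEquiv : _ →L[ℂ] H) ∘L
    lp.mapCLM 2 T hC0 hT ∘L (e.repr.toContinuousLinearEquiv : H →L[ℂ] _)
  have hD : ∀ x n, inner ℂ (e n) (D x) = c n * inner ℂ (e n) x := by
    intro x n
    rw [← e.repr_apply_apply, ← e.repr_apply_apply]
    change (e.repr (e.repr.symm (lp.mapCLM 2 T hC0 hT (e.repr x)))) n = _
    rw [LinearIsometryEquiv.apply_symm_apply]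
    rfl
  refine ⟨D, ?_, ?_, hD⟩
  · let U : ℕ → Submodule ℂ H := fun N => Submodule.span ℂ (e '' Set.Iio N)
    have hU : ∀ N, FiniteDimensional ℂ (U N) := fun N =>
      FiniteDimensional.span_of_finite ℂ ((Set.finite_Iio N).image e)
    have hcomp : ∀ N, IsCompactOperator (D ∘L (U N).starProjection) := fun N => by
      have := FiniteDimensional.proper ℂ (U N)
      exact (isCompactOperator_of_locallyCompactSpace_dom
        (U N).orthogonalProjectionOnto).clm_comp (D ∘L (U N).subtypeL)
    refine isCompactOperator_of_tendsto (F := fun N => D ∘L (U N).starProjection) (l := atTop)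
      (Metric.tendsto_atTop.2 fun ε hε => ?_) (Eventually.of_forall hcomp)
    obtain ⟨N₀, hN₀⟩ := Metric.tendsto_atTop.1 hc (ε / 2) (half_pos hε)
    refine ⟨N₀, fun N hN => lt_of_le_of_lt ?_ (half_lt_self hε)⟩
    rw [dist_comm, dist_eq_norm]
    refine ContinuousLinearMap.opNorm_le_bound _ (half_pos hε).le fun x => ?_
    set z := x - (U N).starProjection x with hz
    have hz1 : (D - D ∘L (U N).starProjection) x = D z := (_root_.map_sub D _ _).symm
    have hz2 : ‖z‖ ≤ ‖x‖ := by
      rw [hz, ← Submodule.starProjection_orthogonal_val]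
      exact Submodule.norm_starProjection_apply_le _ x
    rw [hz1]
    refine (e.norm_le_of_norm_inner_le (half_pos hε).le fun n => ?_).trans
      (mul_le_mul_of_nonneg_left hz2 (half_pos hε).le)
    rw [hD, norm_mul, Complex.norm_real]
    rcases lt_or_ge n N with hn | hn
    · have : inner ℂ (e n) z = 0 :=
        (Submodule.mem_orthogonal _ _).1 (Submodule.sub_starProjection_mem_orthogonal x) _
          (Submodule.subset_span ⟨n, hn, rfl⟩)
      simp [this]
    · have := hN₀ n (hN.trans hn)
      rw [dist_zero_right] at this
      exact mul_le_mul_of_nonneg_right this.le (norm_nonneg _)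
  · rw [ContinuousLinearMap.isSelfAdjoint_iff_isSymmetric]
    intro x y
    change inner ℂ (D x) y = inner ℂ x (D y)
    rw [← e.tsum_inner_mul_inner, ← e.tsum_inner_mul_inner]
    congr 1 with n
    rw [hD, ← inner_conj_symm, hD, ← inner_conj_symm x, map_mul, Complex.conj_ofReal]
    ring

theorem IsDiagonalization.exists_reindex {A : H →ₗ.[ℂ] H} {K : H →L[ℂ] H}
    {e : HilbertBasis ℕ ℂ H} {a : ℕ → ℝ} (hD : IsDiagonalization A K e a) (π : ℕ ≃ ℕ) :
    ∃ e' : HilbertBasis ℕ ℂ H, IsDiagonalization A K e' (a ∘ π) := by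
  obtain ⟨e', he'⟩ := e.exists_reindex π
  refine ⟨e', hD.isCompactOperator, hD.isSelfAdjoint, fun n => he' n ▸ hD.mem_domain (π n),
    fun n => ?_⟩
  have h := hD.apply_basis (π n)
  simp only [he', Function.comp_apply, h]

theorem IsDiagonalization.wvNEquiv {A B : H →ₗ.[ℂ] H} (hA : IsSelfAdjointOp A)
    (hB : IsSelfAdjointOp B) {K L : H →L[ℂ] H} {e f : HilbertBasis ℕ ℂ H} {a b : ℕ → ℝ}
    (hDA : IsDiagonalization A K e a) (hDB : IsDiagonalization B L f b)
    (hab : Tendsto (fun n => b n - a n) atTop (𝓝 0)) : WvNEquiv A B := by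
  obtain ⟨E, hEc, hEs, hE⟩ := f.exists_compact_diagonal hab
  let u : H ≃ₗᵢ[ℂ] H := e.repr.trans f.repr.symm
  have hu : ∀ x n, inner ℂ (f n) (u x) = inner ℂ (e n) x := by
    intro x n
    rw [← f.repr_apply_apply, ← e.repr_apply_apply]
    change f.repr (f.repr.symm (e.repr x)) n = _
    rw [LinearIsometryEquiv.apply_symm_apply]
  let K' : H →L[ℂ] H := (u.toContinuousLinearEquiv : H →L[ℂ] H) ∘L K ∘L
    (u.symm.toContinuousLinearEquiv : H →L[ℂ] H)
  have hK' : ∀ x, K' x = u (K (u.symm x)) := fun x => rfl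
  have hK'c : IsCompactOperator K' := (hDA.isCompactOperator.comp_clm
    (u.symm.toContinuousLinearEquiv : H →L[ℂ] H)).clm_comp (u.toContinuousLinearEquiv : H →L[ℂ] H)
  have hK's : IsSelfAdjoint K' := by
    rw [ContinuousLinearMap.isSelfAdjoint_iff_isSymmetric]
    intro x y
    change inner ℂ (u (K (u.symm x))) y = inner ℂ x (u (K (u.symm y)))
    rw [← u.symm.inner_map_map, ← u.symm.inner_map_map x, u.symm_apply_apply, u.symm_apply_apply]
    exact (ContinuousLinearMap.isSelfAdjoint_iff_isSymmetric.1 hDA.isSelfAdjoint) _ _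
  have hdom : ∀ x, u x ∈ B.domain ↔ x ∈ A.domain := by
    intro x
    have hEm : Memℓp (fun n => ((b n - a n : ℝ) : ℂ) * inner ℂ (e n) x) 2 := by
      have h : (fun n => ((b n - a n : ℝ) : ℂ) * inner ℂ (e n) x) = f.repr (E (u x)) := by
        ext n
        rw [f.repr_apply_apply, hE, hu]
      rw [h]
      exact lp.memℓp _
    rw [hDA.mem_domain_iff hA, hDB.mem_domain_iff hB]
    simp only [hu]
    constructor
    · intro h
      convert h.sub hEm using 1
      ext n
      simp only [Pi.sub_apply]
      push_cast
      ring
    · intro h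
      convert h.add hEm using 1
      ext n
      simp only [Pi.add_apply]
      push_cast
      ring
  refine ⟨u, L - K' + E, (hDB.isCompactOperator.sub hK'c).add hEc,
    (hDB.isSelfAdjoint.sub hK's).add hEs, ?_, fun x hx => f.ext_inner fun n => ?_⟩
  · ext y
    rw [Submodule.mem_map]
    constructor
    · intro hy
      exact ⟨u.symm y, (hdom _).1 (by rwa [u.apply_symm_apply]), u.apply_symm_apply y⟩
    · rintro ⟨x, hx, rfl⟩
      exact (hdom x).2 hx
  · have h1 := hDB.inner_apply hB ⟨u x, hx⟩ n
    have h2 := hDA.inner_apply hA x n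
    rw [inner_sub_right] at h1 h2
    have h3 : (L - K' + E) (u x) = L (u x) - u (K x) + E (u x) := by
      change L (u x) - K' (u x) + E (u x) = _
      rw [hK', u.symm_apply_apply]
    rw [h3, inner_add_right, inner_add_right, inner_sub_right, hE, hu, hu, hu]
    change inner ℂ (f n) (B ⟨u x, hx⟩) - _ = b n * inner ℂ (f n) (u x) at h1
    rw [hu] at h1
    push_cast
    linear_combination h1 - h2

end Equivalence

theorem weyl_vonNeumann_of_noLargeHoles
    {H : Type*} [NormedAddCommGroup H] [InnerProductSpace ℂ H] [CompleteSpace H]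
    [TopologicalSpace.SeparableSpace H] (hdim : ¬ FiniteDimensional ℂ H)
    (M : Set ℝ) (hMclosed : IsClosed M) (hMne : M.Nonempty) (hM : NoLargeHoles M)
    (A B : H →ₗ.[ℂ] H) (hA : IsSelfAdjointOp A) (hB : IsSelfAdjointOp B)
    (hAM : essSpec A = M) (hBM : essSpec B = M) :
    WvNEquiv A B := by
  obtain ⟨K, e, a, hDA⟩ := hA.exists_isDiagonalization hdim
  obtain ⟨L, f, b, hDB⟩ := hB.exists_isDiagonalization hdim
  obtain ⟨π, hπ⟩ := hM.exists_matching (a := a) (b := b)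
    (fun t => by rw [← hAM]; exact hDA.mem_essSpec_iff hA)
    (fun t => by rw [← hBM]; exact hDB.mem_essSpec_iff hB)
  obtain ⟨f', hDB'⟩ := hDB.exists_reindex π
  exact hDA.wvNEquiv hA hB hDB' hπ
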